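/- arXiv:1810.01554 — 5 statements merged into one kernel-verified Lean document; each statement's English description precedes it below -/
import Mathlib

section
/- Let U ⊆ ℂ be a nonempty connected open set, n a natural number, and let λ_1, …, λ_n and μ_1, …, μ_n be holomorphic functions on U. Assume that no two of the functions λ_i globally coincide on U: for all i ≠ j there exists z ∈ U with λ_i(z) ≠ λ_j(z). If for every z ∈ U and every x ∈ ℂ one has ∑_{i=1}^{n} μ_i(z) · ∏_{k ≠ i} (x − λ_k(z)) = 0, then μ_i(z) = 0 for every i and every z ∈ U. -/
open Complex

/-- On a preconnected set, a finite product of analytic functions vanishes identically only if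
one of the factors does. -/
theorem AnalyticOnNhd.exists_forall_eq_zero_of_prod_eq_zero {ι : Type*} {U : Set ℂ}
    (hne : U.Nonempty) (hU : IsPreconnected U) (s : Finset ι) {f : ι → ℂ → ℂ}
    (hf : ∀ k ∈ s, AnalyticOnNhd ℂ (f k) U) (h : ∀ z ∈ U, ∏ k ∈ s, f k z = 0) :
    ∃ k ∈ s, ∀ z ∈ U, f k z = 0 := by
  classical
  induction s using Finset.induction_on with
  | empty =>
    obtain ⟨z, hz⟩ := hne
    simpa using h z hz
  | insert a s ha ih =>
    have hs : ∀ k ∈ s, AnalyticOnNhd ℂ (f k) U := fun k hk => hf k (Finset.mem_insert_of_mem hk)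
    simp only [Finset.prod_insert ha] at h
    rcases AnalyticOnNhd.eq_zero_or_eq_zero_of_mul_eq_zero (hf a (Finset.mem_insert_self a s))
      (s.analyticOnNhd_fun_prod hs) h hU with h0 | h0
    · exact ⟨a, Finset.mem_insert_self a s, h0⟩
    · obtain ⟨k, hk, hk0⟩ := ih hs h0
      exact ⟨k, Finset.mem_insert_of_mem hk, hk0⟩

/-- If no two of the holomorphic functions `λ_i` globally coincide on the nonempty
connected open set `U ⊆ ℂ`, and the first-order variation
`∑_i μ_i(z) ∏_{k ≠ i} (x − λ_k(z))` of the monic polynomial with roots `λ_i(z)`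
vanishes for all `z ∈ U` and all `x ∈ ℂ`, then all the holomorphic coefficient
functions `μ_i` vanish identically on `U`. -/
theorem variation_vanishes_of_no_global_coincidence
    (U : Set ℂ) (hUne : U.Nonempty) (hUopen : IsOpen U) (hUconn : IsConnected U)
    (n : ℕ) (lam mu : Fin n → ℂ → ℂ)
    (hlam : ∀ i, DifferentiableOn ℂ (lam i) U)
    (hmu : ∀ i, DifferentiableOn ℂ (mu i) U)
    (hdist : ∀ i j : Fin n, i ≠ j → ∃ z ∈ U, lam i z ≠ lam j z)
    (hsum : ∀ z ∈ U, ∀ x : ℂ,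
      ∑ i, mu i z * ∏ k ∈ Finset.univ.erase i, (x - lam k z) = 0) :
    ∀ i : Fin n, ∀ z ∈ U, mu i z = 0 := by
  intro i
  have hA : ∀ k ∈ Finset.univ.erase i, AnalyticOnNhd ℂ (fun z => lam i z - lam k z) U :=
    fun k _ => ((hlam i).sub (hlam k)).analyticOnNhd hUopen
  have hprod : ∀ z ∈ U, mu i z * ∏ k ∈ Finset.univ.erase i, (lam i z - lam k z) = 0 := by
    intro z hz
    have hsum_i := hsum z hz (lam i z)
    rwa [Finset.sum_eq_single_of_mem i (Finset.mem_univ i)] at hsum_i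
    intro j _ hji
    exact mul_eq_zero_of_right _ (Finset.prod_eq_zero
      (Finset.mem_erase.mpr ⟨hji.symm, Finset.mem_univ i⟩) (sub_self _))
  rcases AnalyticOnNhd.eq_zero_or_eq_zero_of_mul_eq_zero ((hmu i).analyticOnNhd hUopen)
    (Finset.analyticOnNhd_fun_prod _ hA) hprod hUconn.isPreconnected with h | h
  · exact h
  · obtain ⟨k, hk, hk0⟩ := AnalyticOnNhd.exists_forall_eq_zero_of_prod_eq_zero hUne
      hUconn.isPreconnected _ hA h
    obtain ⟨z, hz, hne⟩ := hdist i k (Finset.ne_of_mem_erase hk).symm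
    exact absurd (sub_eq_zero.mp (hk0 z hz)) hne
end

section
/- Let R > 0 and let f : ℂ → ℂ be analytic on the open ball of radius R centered at 0, with power-series expansion f(z) = ∑_{n≥0} a_n z^n there. Then the function χ(z) = ∑_{n≥0} (a_n/(2n+1)) z^n is analytic on the same open ball of radius R, and for every z in that ball it satisfies the ordinary differential equation χ(z) + 2z·χ′(z) = f(z). -/
open Complex Metric

/-- On `B(0, r)`, dividing the coefficient `a n` by `2 n + 1` leaves the `n`-th term of the power
series bounded by its value at radius `r`. -/
lemma norm_div_two_mul_add_one_mul_pow_le (a : ℕ → ℂ) {r : ℝ} (n : ℕ) {w : ℂ}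
    (hw : w ∈ ball (0 : ℂ) r) :
    ‖a n / (2 * (n : ℂ) + 1) * w ^ n‖ ≤ ‖a n * (r : ℂ) ^ n‖ := by
  have hwr : ‖w‖ ≤ r := (mem_ball_zero_iff.mp hw).le
  have hr : 0 ≤ r := (norm_nonneg w).trans hwr
  have hden : ‖(2 * (n : ℂ) + 1)‖ = 2 * n + 1 := by
    have : (2 * (n : ℂ) + 1) = ((2 * n + 1 : ℕ) : ℂ) := by push_cast; ring
    rw [this, Complex.norm_natCast]
    push_cast
    ring
  rw [norm_mul, norm_mul, norm_div, norm_pow, norm_pow, hden, Complex.norm_real,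
    Real.norm_of_nonneg hr]
  gcongr
  exact div_le_self (norm_nonneg _) (by linarith [n.cast_nonneg (α := ℝ)])

/-- If `f` is analytic on the ball `B(0,R) ⊆ ℂ` with power-series expansion
`f(z) = ∑ aₙ zⁿ` there, then `χ(z) = ∑ (aₙ/(2n+1)) zⁿ` is analytic on the same
ball and satisfies `χ(z) + 2z·χ′(z) = f(z)` there. -/
theorem chi_analytic_and_ode
    (R : ℝ) (hR : 0 < R) (f : ℂ → ℂ) (a : ℕ → ℂ)
    (hf : AnalyticOn ℂ f (ball (0 : ℂ) R))
    (hfa : ∀ z ∈ ball (0 : ℂ) R, HasSum (fun n : ℕ => a n * z ^ n) (f z)) :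
    AnalyticOn ℂ (fun z : ℂ => ∑' n : ℕ, (a n / (2 * (n : ℂ) + 1)) * z ^ n)
        (ball (0 : ℂ) R) ∧
      ∀ z ∈ ball (0 : ℂ) R,
        (∑' n : ℕ, (a n / (2 * (n : ℂ) + 1)) * z ^ n) +
            2 * z * deriv (fun w : ℂ => ∑' n : ℕ, (a n / (2 * (n : ℂ) + 1)) * w ^ n) z
          = f z := by
  have key : ∀ z ∈ ball (0 : ℂ) R, ∃ r : ℝ, z ∈ ball (0 : ℂ) r ∧
      Summable fun n : ℕ => ‖a n * (r : ℂ) ^ n‖ := by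
    intro z hz
    obtain ⟨r, hzr, hrR⟩ := exists_between (mem_ball_zero_iff.mp hz)
    have hr : 0 ≤ r := (norm_nonneg z).trans hzr.le
    refine ⟨r, mem_ball_zero_iff.mpr hzr, (hfa r ?_).summable.norm⟩
    rwa [mem_ball_zero_iff, Complex.norm_real, Real.norm_of_nonneg hr]
  have hdiff : ∀ (r : ℝ) (n : ℕ),
      DifferentiableOn ℂ (fun w : ℂ => a n / (2 * (n : ℂ) + 1) * w ^ n) (ball 0 r) :=
    fun r n => by fun_prop
  constructor
  · refine (DifferentiableOn.analyticOn (fun z hz => ?_) isOpen_ball)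
    obtain ⟨r, hzr, hsum⟩ := key z hz
    exact ((differentiableOn_tsum_of_summable_norm hsum (hdiff r) isOpen_ball fun n w hw =>
      norm_div_two_mul_add_one_mul_pow_le a n hw).differentiableAt
        (isOpen_ball.mem_nhds hzr)).differentiableWithinAt
  · intro z hz
    obtain ⟨r, hzr, hsum⟩ := key z hz
    have hder := hasSum_deriv_of_summable_norm hsum (hdiff r) isOpen_ball
      (fun n w hw => norm_div_two_mul_add_one_mul_pow_le a n hw) hzr
    have hval : Summable fun n : ℕ => a n / (2 * (n : ℂ) + 1) * z ^ n :=
      .of_norm_bounded hsum fun n => norm_div_two_mul_add_one_mul_pow_le a n hzr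
    refine (hval.hasSum.add (hder.mul_left (2 * z))).unique ?_
    convert hfa z hz using 2 with n
    have hn : (2 * (n : ℂ) + 1) ≠ 0 := by exact_mod_cast (2 * n).succ_ne_zero
    have hd : deriv (fun w : ℂ => a n / (2 * (n : ℂ) + 1) * w ^ n) z =
        a n / (2 * (n : ℂ) + 1) * (n * z ^ (n - 1)) :=
      ((hasDerivAt_pow n z).const_mul _).deriv
    have hpow : (n : ℂ) * (z * z ^ (n - 1)) = n * z ^ n := by
      cases n with
      | zero => simp
      | succ k => rw [Nat.add_sub_cancel, pow_succ']
    calc _ = a n / (2 * (n : ℂ) + 1) * (z ^ n + 2 * (n * (z * z ^ (n - 1)))) := by rw [hd]; ring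
      _ = a n * z ^ n := by rw [hpow]; field_simp; ring
end

section
/- Let K ⊆ ℂ be a nonempty compact set, and let f, g, k : ℂ → ℝ be functions such that f is continuous on K, g and k are continuous on K, k > 0 on K, and f is twice continuously differentiable on the interior of K, where it satisfies the equation Δf = k²·f − g (with Δ the Laplacian ∂²f/∂x² + ∂²f/∂y² in the two real coordinates of ℂ). Then for every x ∈ K, |f(x)| ≤ max( sup_{y ∈ ∂K} |f(y)| , sup_{y ∈ K} |g(y)|/k(y)² ), where ∂K denotes the topological frontier of K. -/
open Complex

/-- The Laplacian of `f : ℂ → ℝ` in the two real coordinates of `ℂ`: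
the sum of the two pure second partial derivatives. -/
noncomputable def realLaplacian (f : ℂ → ℝ) (z : ℂ) : ℝ :=
  iteratedFDeriv ℝ 2 f z ![1, 1] + iteratedFDeriv ℝ 2 f z ![Complex.I, Complex.I]

open Filter Topology

/-- At a local maximum, the second derivative of a function of one real variable is nonpositive. -/
lemma deriv_deriv_nonpos_of_isLocalMax {φ : ℝ → ℝ} {a : ℝ} (h : IsLocalMax φ a)
    (hc : ContinuousAt φ a) : deriv (deriv φ) a ≤ 0 := by
  by_contra! hpos
  have hmin : IsLocalMin φ a := isLocalMin_of_deriv_deriv_pos hpos h.deriv_eq_zero hc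
  have hconst : φ =ᶠ[𝓝 a] fun _ => φ a := by
    filter_upwards [h, hmin] with y h₁ h₂ using le_antisymm h₁ h₂
  have hzero : deriv (deriv φ) a = 0 := by
    rw [hconst.deriv.deriv_eq]
    simp
  exact hpos.ne' hzero

/-- At a local maximum, the pure second derivatives of a `C²` function are nonpositive. -/
lemma iteratedFDeriv_two_nonpos_of_isLocalMax {E : Type*} [NormedAddCommGroup E] [NormedSpace ℝ E]
    {f : E → ℝ} {z : E} (hf : ContDiffAt ℝ 2 f z) (h : IsLocalMax f z) (v : E) :
    iteratedFDeriv ℝ 2 f z ![v, v] ≤ 0 := by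
  have hline (t : ℝ) : HasDerivAt (fun t : ℝ => z + t • v) v t := by
    simpa using ((hasDerivAt_id t).smul_const v).const_add z
  have htend : Tendsto (fun t : ℝ => z + t • v) (𝓝 0) (𝓝 z) := by
    simpa using (hline 0).continuousAt.tendsto
  have hderiv : deriv (fun t : ℝ => f (z + t • v)) =ᶠ[𝓝 0]
      fun t => fderiv ℝ f (z + t • v) v := by
    filter_upwards [htend.eventually (hf.eventually (by simp))] with t ht
    exact ((ht.differentiableAt (by simp)).hasFDerivAt.comp_hasDerivAt t (hline t)).deriv
  have hdiff : DifferentiableAt ℝ (fderiv ℝ f) (z + (0 : ℝ) • v) := by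
    simpa using (hf.fderiv_right (m := 1) (by norm_num)).differentiableAt (by simp)
  have hsecond : deriv (deriv fun t : ℝ => f (z + t • v)) 0 = fderiv ℝ (fderiv ℝ f) z v v := by
    rw [hderiv.deriv_eq]
    have hpath : HasDerivAt (fun t : ℝ => fderiv ℝ f (z + t • v))
        (fderiv ℝ (fderiv ℝ f) (z + (0 : ℝ) • v) v) 0 :=
      hdiff.hasFDerivAt.comp_hasDerivAt (0 : ℝ) (hline 0)
    have heval : HasDerivAt (fun t : ℝ => fderiv ℝ f (z + t • v) v)
        (fderiv ℝ (fderiv ℝ f) (z + (0 : ℝ) • v) v v) 0 :=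
      (ContinuousLinearMap.apply ℝ ℝ v).hasFDerivAt.comp_hasDerivAt (0 : ℝ) hpath
    rw [heval.deriv, zero_smul, add_zero]
  have hmax : IsLocalMax (fun t : ℝ => f (z + t • v)) 0 := by
    filter_upwards [htend.eventually h] with t ht
    simpa using ht
  have hcont : ContinuousAt (fun t : ℝ => f (z + t • v)) 0 := by
    have : Tendsto (fun t : ℝ => f (z + t • v)) (𝓝 0) (𝓝 (f z)) :=
      hf.continuousAt.tendsto.comp htend
    simpa [ContinuousAt] using this
  have := deriv_deriv_nonpos_of_isLocalMax hmax hcont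
  rw [hsecond] at this
  simpa [iteratedFDeriv_two_apply] using this

/-- The Laplacian of a `C²` function is nonpositive at a local maximum. -/
lemma realLaplacian_nonpos_of_isLocalMax {f : ℂ → ℝ} {z : ℂ} (hf : ContDiffAt ℝ 2 f z)
    (h : IsLocalMax f z) : realLaplacian f z ≤ 0 :=
  add_nonpos (iteratedFDeriv_two_nonpos_of_isLocalMax hf h 1)
    (iteratedFDeriv_two_nonpos_of_isLocalMax hf h Complex.I)

lemma realLaplacian_neg (f : ℂ → ℝ) (z : ℂ) :
    realLaplacian (fun w => -f w) z = -realLaplacian f z := by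
  have : iteratedFDeriv ℝ 2 (fun w => -f w) z = -iteratedFDeriv ℝ 2 f z :=
    iteratedFDeriv_neg_apply
  simp only [realLaplacian, this, neg_apply]
  ring

/-- A nonnegative continuous function on a compact set is bounded by its supremum over the set. -/
lemma IsCompact.le_biSup_of_nonneg {X : Type*} [TopologicalSpace X] {s : Set X} (hs : IsCompact s)
    {u : X → ℝ} (hu : ContinuousOn u s) (hu₀ : ∀ y ∈ s, 0 ≤ u y) {x : X} (hx : x ∈ s) :
    u x ≤ ⨆ y ∈ s, u y := by
  obtain ⟨C, hC⟩ := hs.bddAbove_image hu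
  have hbdd : BddAbove (Set.range fun y => ⨆ _ : y ∈ s, u y) := by
    refine ⟨C, ?_⟩
    rintro _ ⟨y, rfl⟩
    exact Real.iSup_le (fun hy => hC ⟨y, hy, rfl⟩)
      ((hu₀ x hx).trans (hC ⟨x, hx, rfl⟩))
  have := le_ciSup hbdd x
  simpa [hx] using this

/-- At an interior maximum of `f` where `Δf = c f - b` with `c > 0`, one has `f ≤ |b| / c`. -/
lemma le_abs_div_of_isLocalMax {f : ℂ → ℝ} {z : ℂ} {b c : ℝ} (hc : 0 < c)
    (hf : ContDiffAt ℝ 2 f z) (h : IsLocalMax f z) (heq : realLaplacian f z = c * f z - b) :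
    f z ≤ |b| / c := by
  rw [le_div_iff₀ hc]
  linarith [realLaplacian_nonpos_of_isLocalMax hf h, le_abs_self b]

/-- Maximum principle bound: if `f` is continuous on the nonempty compact set
`K ⊆ ℂ`, twice continuously differentiable on its interior where it satisfies
`Δf = k²·f − g` (with `k > 0` on `K`), then `|f| ≤ max(sup_{∂K} |f|, sup_K |g|/k²)`
on all of `K`. -/
theorem maximum_principle_bound
    (K : Set ℂ) (hKne : K.Nonempty) (hK : IsCompact K)
    (f g k : ℂ → ℝ)
    (hf : ContinuousOn f K) (hg : ContinuousOn g K) (hk : ContinuousOn k K)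
    (hkpos : ∀ x ∈ K, 0 < k x)
    (hf2 : ContDiffOn ℝ 2 f (interior K))
    (heq : ∀ z ∈ interior K, realLaplacian f z = k z ^ 2 * f z - g z) :
    ∀ x ∈ K,
      |f x| ≤ max (⨆ y ∈ frontier K, |f y|) (⨆ y ∈ K, |g y| / k y ^ 2) := by
  intro x hx
  obtain ⟨z, hz, hmax⟩ := hK.exists_isMaxOn hKne hf.abs
  refine (hmax hx).trans ?_
  by_cases hzi : z ∈ interior K
  · refine le_max_of_le_right (le_trans ?_ (hK.le_biSup_of_nonneg
      (hg.abs.div (hk.pow 2) fun y hy => (pow_pos (hkpos y hy) 2).ne')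
      (fun y _ => div_nonneg (abs_nonneg _) (sq_nonneg _)) hz))
    have hnhds : K ∈ 𝓝 z := mem_interior_iff_mem_nhds.mp hzi
    have hfz : ContDiffAt ℝ 2 f z := hf2.contDiffAt (isOpen_interior.mem_nhds hzi)
    have hkz : 0 < k z ^ 2 := pow_pos (hkpos z hz) 2
    rcases abs_cases (f z) with ⟨habs, -⟩ | ⟨habs, -⟩
    · have hloc : IsLocalMax f z := by
        filter_upwards [hnhds] with y hy
        exact (le_abs_self _).trans ((hmax hy).trans_eq habs)
      exact habs.trans_le (le_abs_div_of_isLocalMax hkz hfz hloc (heq z hzi))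
    · have hloc : IsLocalMax (fun w => -f w) z := by
        filter_upwards [hnhds] with y hy
        exact (neg_le_abs _).trans ((hmax hy).trans_eq habs)
      have hlap : realLaplacian (fun w => -f w) z = k z ^ 2 * -f z - -g z := by
        rw [realLaplacian_neg, heq z hzi]
        ring
      have := le_abs_div_of_isLocalMax hkz hfz.neg hloc hlap
      rw [abs_neg] at this
      exact habs.trans_le this
  · have hfr : frontier K ⊆ K := hK.isClosed.frontier_subset
    exact le_max_of_le_left ((hK.of_isClosed_subset isClosed_frontier hfr).le_biSup_of_nonneg
      (hf.abs.mono hfr) (fun y _ => abs_nonneg _) ⟨subset_closure hz, hzi⟩)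
end

section
/- Let R be a commutative ring and let l, m, z, a, b ∈ R. Set δ = l − m and assume z − δ² is a unit in R with inverse w. Define the 3×3 matrices A = [[l, z, 0], [1, l, 0], [0, 0, m]], P = [[0, 0, a], [0, 0, b], [0, 0, 0]], and γ = [[0, 0, (−b·z + a·δ)·w], [0, 0, (−a + b·δ)·w], [0, 0, 0]]. Then P + (A·γ − γ·A) = 0. -/
/-- The infinitesimal gauge transformation killing the `2 × 1` off-diagonal block of
a Higgs-field variation: with `δ = l − m` and `w` the inverse of the unit `z − δ²`,
for `A = [[l,z,0],[1,l,0],[0,0,m]]`, `P = [[0,0,a],[0,0,b],[0,0,0]]`, and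
`γ = [[0,0,(−bz+aδ)w],[0,0,(−a+bδ)w],[0,0,0]]` one has `P + [A, γ] = 0`. -/
theorem gauge_kills_two_by_one_block
    (R : Type*) [CommRing R] (l m z a b : R)
    (w : R) (hw : (z - (l - m) ^ 2) * w = 1) (hw' : w * (z - (l - m) ^ 2) = 1) :
    (!![0, 0, a; 0, 0, b; 0, 0, 0] : Matrix (Fin 3) (Fin 3) R) +
        (!![l, z, 0; 1, l, 0; 0, 0, m] *
            !![0, 0, (-(b * z) + a * (l - m)) * w;
               0, 0, (-a + b * (l - m)) * w;
               0, 0, 0] -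
          !![0, 0, (-(b * z) + a * (l - m)) * w;
             0, 0, (-a + b * (l - m)) * w;
             0, 0, 0] * !![l, z, 0; 1, l, 0; 0, 0, m])
      = 0 := by
  ext i j
  fin_cases i <;> fin_cases j <;> simp
  · linear_combination -a * hw
  · linear_combination -b * hw
end

section
/- Let R be a commutative ring and let l, m, z, a, b, c, d ∈ R. Set δ = l − m and assume δ³ − 4zδ is a unit in R with inverse u. Define the 4×4 block matrices A = [[l, z, 0, 0], [1, l, 0, 0], [0, 0, m, z], [0, 0, 1, m]] and P, whose only nonzero entries are its top-right 2×2 block [[a, b], [c, d]], and let γ be the 4×4 matrix whose only nonzero entries are its top-right 2×2 block [[g₁, g₂], [g₃, g₄]] with g₁ = (2dz + a(2z − δ²) − (b − cz)δ)·u, g₂ = (2cz² + b(2z − δ²) − (a − d)zδ)·u, g₃ = (2b + 2cz + (a − d)δ − cδ²)·u, g₄ = (2az + d(2z − δ²) + (b − cz)δ)·u. Then P + (A·γ − γ·A) = 0. -/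
/-- The infinitesimal gauge transformation killing the `2 × 2` off-diagonal block of
a Higgs-field variation: with `δ = l − m` and `u` the inverse of the unit
`δ³ − 4zδ`, for the block-diagonal Higgs field
`A = [[l,z,0,0],[1,l,0,0],[0,0,m,z],[0,0,1,m]]`, the variation `P` with top-right
block `[[a,b],[c,d]]`, and the gauge parameter `γ` with top-right block
`[[g₁,g₂],[g₃,g₄]]` as given, one has `P + [A, γ] = 0`. -/
theorem gauge_kills_two_by_two_block
    (R : Type*) [CommRing R] (l m z a b c d : R)
    (u : R)
    (hu : ((l - m) ^ 3 - 4 * z * (l - m)) * u = 1)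
    (hu' : u * ((l - m) ^ 3 - 4 * z * (l - m)) = 1) :
    (!![0, 0, a, b; 0, 0, c, d; 0, 0, 0, 0; 0, 0, 0, 0] :
          Matrix (Fin 4) (Fin 4) R) +
        (!![l, z, 0, 0; 1, l, 0, 0; 0, 0, m, z; 0, 0, 1, m] *
            !![0, 0, (2 * d * z + a * (2 * z - (l - m) ^ 2) - (b - c * z) * (l - m)) * u,
                     (2 * c * z ^ 2 + b * (2 * z - (l - m) ^ 2) - (a - d) * z * (l - m)) * u;
               0, 0, (2 * b + 2 * c * z + (a - d) * (l - m) - c * (l - m) ^ 2) * u,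
                     (2 * a * z + d * (2 * z - (l - m) ^ 2) + (b - c * z) * (l - m)) * u;
               0, 0, 0, 0;
               0, 0, 0, 0] -
          !![0, 0, (2 * d * z + a * (2 * z - (l - m) ^ 2) - (b - c * z) * (l - m)) * u,
                   (2 * c * z ^ 2 + b * (2 * z - (l - m) ^ 2) - (a - d) * z * (l - m)) * u;
             0, 0, (2 * b + 2 * c * z + (a - d) * (l - m) - c * (l - m) ^ 2) * u,
                   (2 * a * z + d * (2 * z - (l - m) ^ 2) + (b - c * z) * (l - m)) * u;
             0, 0, 0, 0;
             0, 0, 0, 0] *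
            !![l, z, 0, 0; 1, l, 0, 0; 0, 0, m, z; 0, 0, 1, m])
      = 0 := by
  ext i j
  fin_cases i <;> fin_cases j <;> simp
  · linear_combination -a * hu
  · linear_combination -b * hu
  · linear_combination -c * hu
  · linear_combination -d * hu
end
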